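/- arXiv:2103.09209 — 3 statements merged into one kernel-verified Lean document; each statement's English description precedes it below -/
import Mathlib

section
/- For a sequence (a_n) of nonnegative reals decreasing to zero and 1 ≤ p < ∞, the function f(z) = Σ a_n z^n belongs to the Hardy space H^p if and only if Σ_{n≥0} a_n^p (n+1)^{p-2} < ∞. -/
open Real Complex

/-- The series `∑ bₙ e^{inθ}`. -/
noncomputable def expSeries (b : ℕ → ℝ) (θ : ℝ) : ℂ :=
  ∑' n : ℕ, (b n : ℂ) * Complex.exp (Complex.I * θ) ^ n

/-- The term of the condensed series attached to the block `2 ^ k ≤ n < 2 ^ (k + 1)`. -/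
noncomputable def condensedTerm (p : ℝ) (b : ℕ → ℝ) (k : ℕ) : ℝ :=
  (2 ^ k * b (2 ^ k)) ^ p / 2 ^ k

theorem norm_exp_I_mul (θ : ℝ) : ‖Complex.exp (Complex.I * θ)‖ = 1 := by
  rw [mul_comm]; exact Complex.norm_exp_ofReal_mul_I θ

theorem norm_coeff_mul_pow {w : ℂ} (hw : ‖w‖ = 1) {b : ℕ → ℝ} (hb : ∀ n, 0 ≤ b n) (n m : ℕ) :
    ‖(b n : ℂ) * w ^ m‖ = b n := by
  simp [hw, abs_of_nonneg (hb n)]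

theorem summable_coeff_mul_pow {w : ℂ} (hw : ‖w‖ = 1) {b : ℕ → ℝ} (hb : ∀ n, 0 ≤ b n)
    (hs : Summable b) : Summable fun n => (b n : ℂ) * w ^ n :=
  Summable.of_norm (by simpa only [norm_coeff_mul_pow hw hb] using hs)

theorem hasSum_sub_succ {b : ℕ → ℝ} (hs : Summable b) :
    HasSum (fun n => b n - b (n + 1)) (b 0) := by
  have h1 : Summable fun n => b (n + 1) := (summable_nat_add_iff 1).2 hs
  have h := hs.hasSum.sub h1.hasSum
  rwa [hs.tsum_eq_zero_add, add_sub_cancel_right] at h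

/-- Summation by parts. -/
theorem hasSum_one_sub_mul {w : ℂ} (hw : ‖w‖ = 1) {b : ℕ → ℝ} (hb : ∀ n, 0 ≤ b n)
    (hs : Summable b) :
    HasSum (fun n => ((b n - b (n + 1) : ℝ) : ℂ) * (1 - w ^ (n + 1)))
      ((1 - w) * ∑' n, (b n : ℂ) * w ^ n) := by
  have h0 := summable_coeff_mul_pow hw hb hs
  have h1 : Summable fun n => (b (n + 1) : ℂ) * w ^ (n + 1) :=
    (summable_nat_add_iff (f := fun n => (b n : ℂ) * w ^ n) 1).2 h0
  have h2 : HasSum (fun n => ((b n - b (n + 1) : ℝ) : ℂ)) (b 0 : ℂ) :=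
    Complex.hasSum_ofReal.2 (hasSum_sub_succ hs)
  have h := h2.sub ((h0.hasSum.mul_left w).sub h1.hasSum)
  have e := h0.tsum_eq_zero_add
  have e1 : (1 - w) * ∑' n, (b n : ℂ) * w ^ n = (b 0 : ℂ) -
      (w * ∑' n, (b n : ℂ) * w ^ n - ∑' n, (b (n + 1) : ℂ) * w ^ (n + 1)) := by
    rw [pow_zero, mul_one] at e
    linear_combination e
  rw [e1]
  have e2 : (fun n => ((b n - b (n + 1) : ℝ) : ℂ) * (1 - w ^ (n + 1))) = fun n =>
      ((b n - b (n + 1) : ℝ) : ℂ) - (w * ((b n : ℂ) * w ^ n) - (b (n + 1) : ℂ) * w ^ (n + 1)) := by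
    ext n; push_cast; ring
  rwa [e2]

theorem continuous_expSeries {b : ℕ → ℝ} (hb : ∀ n, 0 ≤ b n) (hs : Summable b) :
    Continuous (expSeries b) := by
  refine continuous_tsum (fun n => by fun_prop) hs fun n θ => ?_
  rw [norm_coeff_mul_pow (norm_exp_I_mul θ) hb]

theorem continuous_norm_expSeries_rpow {b : ℕ → ℝ} (hb : ∀ n, 0 ≤ b n) (hs : Summable b)
    {p : ℝ} (hp : 0 ≤ p) : Continuous fun θ => ‖expSeries b θ‖ ^ p :=
  (continuous_expSeries hb hs).norm.rpow_const fun _ => Or.inr hp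

theorem norm_expSeries_two_pi_sub (b : ℕ → ℝ) (θ : ℝ) :
    ‖expSeries b (2 * π - θ)‖ = ‖expSeries b θ‖ := by
  rw [← Complex.norm_conj (expSeries b θ), expSeries, expSeries, Complex.conj_tsum]
  congr 2; ext n
  rw [map_mul, map_pow, Complex.conj_ofReal, ← Complex.exp_conj]
  congr 2
  rw [Complex.exp_eq_exp_iff_exists_int]
  refine ⟨1, ?_⟩
  simp; ring

theorem integral_expSeries_eq_two_mul {b : ℕ → ℝ} (hb : ∀ n, 0 ≤ b n) (hs : Summable b)
    {p : ℝ} (hp : 0 ≤ p) :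
    ∫ θ in (0:ℝ)..(2 * π), ‖expSeries b θ‖ ^ p = 2 * ∫ θ in (0:ℝ)..π, ‖expSeries b θ‖ ^ p := by
  have hc := continuous_norm_expSeries_rpow hb hs hp
  rw [← intervalIntegral.integral_add_adjacent_intervals (b := π)
    (hc.intervalIntegrable _ _) (hc.intervalIntegrable _ _)]
  have h := intervalIntegral.integral_comp_sub_left (a := 0) (b := π)
    (fun θ => ‖expSeries b θ‖ ^ p) (2 * π)
  simp only [norm_expSeries_two_pi_sub] at h
  rw [sub_zero, show 2 * π - π = π by ring] at h
  rw [← h]; ring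

theorem norm_one_sub_exp_le {θ : ℝ} (h0 : 0 ≤ θ) : ‖1 - Complex.exp (Complex.I * θ)‖ ≤ θ := by
  rw [norm_sub_rev]
  simpa [abs_of_nonneg h0] using Real.norm_exp_I_mul_ofReal_sub_one_le (x := θ)

theorem le_norm_one_sub_exp {θ : ℝ} (h0 : 0 ≤ θ) (h1 : θ ≤ π) :
    2 * θ / π ≤ ‖1 - Complex.exp (Complex.I * θ)‖ := by
  rw [norm_sub_rev, Complex.norm_exp_I_mul_ofReal_sub_one]
  have h := Real.mul_le_sin (x := θ / 2) (by linarith) (by linarith)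
  rw [Real.norm_eq_abs]
  refine le_trans ?_ (le_abs_self _)
  calc 2 * θ / π = 2 * (2 / π * (θ / 2)) := by ring
    _ ≤ _ := by linarith

theorem mul_norm_tsum_le {w : ℂ} (hw : ‖w‖ = 1) {b : ℕ → ℝ} (hb : ∀ n, 0 ≤ b n)
    (hd : Antitone b) (hs : Summable b) : ‖1 - w‖ * ‖∑' n, (b n : ℂ) * w ^ n‖ ≤ 2 * b 0 := by
  rw [← norm_mul, ← (hasSum_one_sub_mul hw hb hs).tsum_eq]
  refine tsum_of_norm_bounded ((hasSum_sub_succ hs).mul_left 2) fun n => ?_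
  have h1 : ‖1 - w ^ (n + 1)‖ ≤ 2 := by
    refine (norm_sub_le _ _).trans ?_
    simp [hw]; norm_num
  have h2 : 0 ≤ b n - b (n + 1) := sub_nonneg.2 (hd n.le_succ)
  rw [norm_mul, Complex.norm_real, Real.norm_of_nonneg h2]
  nlinarith

theorem norm_expSeries_le {b : ℕ → ℝ} (hb : ∀ n, 0 ≤ b n)
    (hd : Antitone b) (hs : Summable b) (N : ℕ) {θ : ℝ} (h0 : 0 < θ) (h1 : θ ≤ π) :
    ‖expSeries b θ‖ ≤ ∑ n ∈ Finset.range N, b n + π / θ * b N := by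
  set w := Complex.exp (Complex.I * θ)
  have hw : ‖w‖ = 1 := norm_exp_I_mul θ
  have ht := mul_norm_tsum_le hw (b := fun n => b (n + N)) (fun n => hb _)
    (fun i j hij => hd (by omega)) ((summable_nat_add_iff N).2 hs)
  have hl := le_norm_one_sub_exp h0.le h1
  rw [zero_add] at ht
  rw [expSeries, ← (summable_coeff_mul_pow hw hb hs).sum_add_tsum_nat_add N]
  refine (norm_add_le _ _).trans (add_le_add ?_ ?_)
  · refine (norm_sum_le _ _).trans (Finset.sum_le_sum fun n _ => ?_)
    rw [norm_coeff_mul_pow hw hb]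
  · have e : ∀ n, (b (n + N) : ℂ) * w ^ (n + N) = w ^ N * ((b (n + N) : ℂ) * w ^ n) :=
      fun n => by ring
    simp only [e]
    rw [tsum_mul_left, norm_mul, norm_pow, hw, one_pow, one_mul]
    set T := ‖∑' n, (b (n + N) : ℂ) * w ^ n‖
    have hT : 0 ≤ T := norm_nonneg _
    have h3 : 2 * θ / π * T ≤ 2 * b N := (mul_le_mul_of_nonneg_right hl hT).trans ht
    have hπ := Real.pi_pos
    rw [div_mul_eq_mul_div, le_div_iff₀ h0]
    rw [div_mul_eq_mul_div, div_le_iff₀ hπ] at h3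
    nlinarith

theorem sum_le_mul_norm_expSeries {b : ℕ → ℝ} (hb : ∀ n, 0 ≤ b n)
    (hd : Antitone b) (hs : Summable b) (s : Finset ℕ) {θ : ℝ} (h0 : 0 ≤ θ) :
    ∑ n ∈ s, (b n - b (n + 1)) * (1 - Real.cos ((n + 1 : ℕ) * θ)) ≤ θ * ‖expSeries b θ‖ := by
  have h := Complex.hasSum_re (hasSum_one_sub_mul (norm_exp_I_mul θ) hb hs)
  have e : ∀ n : ℕ, (((b n - b (n + 1) : ℝ) : ℂ) *
      (1 - Complex.exp (Complex.I * θ) ^ (n + 1))).re =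
      (b n - b (n + 1)) * (1 - Real.cos ((n + 1 : ℕ) * θ)) := fun n => by
    rw [Complex.re_ofReal_mul, ← Complex.exp_nat_mul, Complex.sub_re, Complex.one_re,
      show ((n + 1 : ℕ) : ℂ) * (Complex.I * θ) = (((n + 1 : ℕ) * θ : ℝ) : ℂ) * Complex.I by
        push_cast; ring, Complex.exp_ofReal_mul_I_re]
  simp only [e] at h
  refine (sum_le_hasSum s (fun n _ => mul_nonneg (sub_nonneg.2 (hd n.le_succ))
    (sub_nonneg.2 (Real.cos_le_one _))) h).trans ((Complex.re_le_norm _).trans ?_)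
  rw [norm_mul]
  exact mul_le_mul_of_nonneg_right (norm_one_sub_exp_le h0) (norm_nonneg _)

theorem half_le_integral_one_sub_cos {s : ℝ} {m : ℕ} (hs : 0 < s) (hm : 4 ≤ m * s) :
    s / 2 ≤ ∫ θ in s..(2 * s), (1 - Real.cos (m * θ)) := by
  have hm0 : (0:ℝ) < m := by
    by_contra h
    nlinarith
  rw [intervalIntegral.integral_sub (by simp) ((by fun_prop : Continuous _).intervalIntegrable _ _),
    intervalIntegral.integral_comp_mul_left (fun x => Real.cos x) hm0.ne', integral_cos]
  simp only [intervalIntegral.integral_const, smul_eq_mul]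
  have h1 := Real.sin_le_one (m * (2 * s))
  have h2 := Real.neg_one_le_sin (m * s)
  have h3 : (m:ℝ)⁻¹ * (Real.sin (m * (2 * s)) - Real.sin (m * s)) ≤ s / 2 := by
    rw [inv_mul_le_iff₀ hm0]; nlinarith
  linarith

theorem le_integral_norm_expSeries {b : ℕ → ℝ} (hb : ∀ n, 0 ≤ b n)
    (hd : Antitone b) (hs : Summable b) {s : ℝ} (h0 : 0 < s) {N : ℕ} (hN : 4 ≤ N * s) :
    b N / 4 ≤ ∫ θ in s..(2 * s), ‖expSeries b θ‖ := by
  have hc := continuous_expSeries hb hs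
  have key : ∀ M, N ≤ M → (b N - b M) / 4 ≤ ∫ θ in s..(2 * s), ‖expSeries b θ‖ := by
    intro M hM
    have h1 : ∫ θ in s..(2 * s), ∑ n ∈ Finset.Ico N M,
        (b n - b (n + 1)) * (1 - Real.cos ((n + 1 : ℕ) * θ)) ≤
        ∫ θ in s..(2 * s), 2 * s * ‖expSeries b θ‖ := by
      refine intervalIntegral.integral_mono_on (by linarith)
        ((by fun_prop : Continuous _).intervalIntegrable _ _)
        ((by fun_prop : Continuous _).intervalIntegrable _ _) fun θ hθ => ?_
      exact (sum_le_mul_norm_expSeries hb hd hs _ (h0.le.trans hθ.1)).trans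
        (mul_le_mul_of_nonneg_right hθ.2 (norm_nonneg _))
    rw [intervalIntegral.integral_finsetSum fun n _ =>
      (by fun_prop : Continuous _).intervalIntegrable _ _,
      intervalIntegral.integral_const_mul] at h1
    have h2 : ∑ n ∈ Finset.Ico N M, (b n - b (n + 1)) * (s / 2) ≤
        2 * s * ∫ θ in s..(2 * s), ‖expSeries b θ‖ := by
      refine (Finset.sum_le_sum fun n hn => ?_).trans h1
      rw [intervalIntegral.integral_const_mul]
      refine mul_le_mul_of_nonneg_left (half_le_integral_one_sub_cos h0 ?_)
        (sub_nonneg.2 (hd n.le_succ))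
      have : (N:ℝ) ≤ (n + 1 : ℕ) := by
        exact_mod_cast (Finset.mem_Ico.1 hn).1.trans n.le_succ
      nlinarith
    rw [← Finset.sum_mul] at h2
    have h3 : ∑ n ∈ Finset.Ico N M, (b n - b (n + 1)) = b N - b M := by
      have := Finset.sum_Ico_sub b hM
      rw [← neg_sub (b M), ← this, ← Finset.sum_neg_distrib]
      simp
    rw [h3] at h2
    nlinarith
  have hl : Filter.Tendsto (fun M => (b N - b M) / 4) Filter.atTop (nhds ((b N - 0) / 4)) :=
    (tendsto_const_nhds.sub hs.tendsto_atTop_zero).div_const 4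
  rw [sub_zero] at hl
  exact le_of_tendsto hl (Filter.eventually_atTop.2 ⟨N, key⟩)

/-- Jensen's inequality for `x ↦ x ^ p` on an interval. -/
theorem mul_rpow_le_integral_rpow {p : ℝ} (hp : 1 ≤ p) {u : ℝ → ℝ} (hu : Continuous u)
    (hu0 : ∀ x, 0 ≤ u x) {s t c : ℝ} (hst : s < t) (hc : 0 ≤ c)
    (h : c * (t - s) ≤ ∫ x in s..t, u x) : (t - s) * c ^ p ≤ ∫ x in s..t, u x ^ p := by
  have hcont : Continuous fun x => u x ^ p := hu.rpow_const fun _ => Or.inr (by linarith)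
  rcases hc.eq_or_lt with rfl | hc
  · rw [Real.zero_rpow (by linarith), mul_zero]
    exact intervalIntegral.integral_nonneg hst.le fun x _ => Real.rpow_nonneg (hu0 x) p
  have hpt : ∀ x, c ^ p * (1 + p * (u x / c - 1)) ≤ u x ^ p := fun x => by
    have h1 := one_add_mul_self_le_rpow_one_add (s := u x / c - 1) (p := p)
      (by linarith [div_nonneg (hu0 x) hc.le]) hp
    rw [add_sub_cancel, Real.div_rpow (hu0 x) hc.le] at h1
    rwa [mul_comm, ← le_div_iff₀ (Real.rpow_pos_of_pos hc p)]
  have h2 := intervalIntegral.integral_mono (μ := MeasureTheory.volume) hst.le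
    ((by fun_prop : Continuous fun x => c ^ p * (1 + p * (u x / c - 1))).intervalIntegrable _ _)
    (hcont.intervalIntegrable _ _) hpt
  refine le_trans ?_ h2
  have e : (∫ x in s..t, c ^ p * (1 + p * (u x / c - 1))) =
      c ^ p * ((t - s) + p * ((∫ x in s..t, u x) / c - (t - s))) := by
    rw [intervalIntegral.integral_const_mul, intervalIntegral.integral_add (by simp)
      ((by fun_prop : Continuous _).intervalIntegrable _ _), intervalIntegral.integral_const_mul,
      intervalIntegral.integral_sub ((by fun_prop : Continuous _).intervalIntegrable _ _) (by simp),
      intervalIntegral.integral_div]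
    simp
  rw [e, mul_comm]
  refine mul_le_mul_of_nonneg_left ?_ (Real.rpow_nonneg hc.le p)
  have : t - s ≤ (∫ x in s..t, u x) / c := by rw [le_div_iff₀ hc]; linarith
  nlinarith

theorem condensedTerm_nonneg (p : ℝ) {b : ℕ → ℝ} (hb : ∀ n, 0 ≤ b n) (k : ℕ) :
    0 ≤ condensedTerm p b k :=
  div_nonneg (Real.rpow_nonneg (mul_nonneg (by positivity) (hb _)) p) (by positivity)

theorem sum_integral_dyadic {g : ℝ → ℝ} (hg : Continuous g) (c : ℝ) (K : ℕ) :
    ∑ k ∈ Finset.range K, ∫ x in (c / 2 ^ (k + 1))..(c / 2 ^ k), g x =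
      ∫ x in (c / 2 ^ K)..c, g x := by
  induction K with
  | zero => simp
  | succ K ih =>
    rw [Finset.sum_range_succ, ih, add_comm, intervalIntegral.integral_add_adjacent_intervals
      (hg.intervalIntegrable _ _) (hg.intervalIntegrable _ _)]

theorem condensedTerm_le_integral {b : ℕ → ℝ} (hb : ∀ n, 0 ≤ b n) (hd : Antitone b)
    (hs : Summable b) {p : ℝ} (hp : 1 ≤ p) (k : ℕ) :
    2 * π / (8 * π) ^ p * condensedTerm p b (k + 2) ≤
      ∫ θ in (π / 2 ^ (k + 1))..(π / 2 ^ k), ‖expSeries b θ‖ ^ p := by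
  have hπ := Real.pi_pos
  have h2 : (0:ℝ) < 2 ^ k := by positivity
  have hs0 : 0 < π / 2 ^ (k + 1) := by positivity
  have e2 : 2 * (π / 2 ^ (k + 1)) = π / 2 ^ k := by rw [pow_succ]; field_simp
  have h := le_integral_norm_expSeries hb hd hs hs0 (N := 2 ^ (k + 2)) (by
    have : ((2 ^ (k + 2) : ℕ) : ℝ) * (π / 2 ^ (k + 1)) = 2 * π := by
      push_cast; rw [pow_succ, pow_succ]; field_simp
    rw [this]; linarith [Real.two_le_pi])
  rw [e2] at h
  have hlt : π / 2 ^ (k + 1) < π / 2 ^ k := by linarith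
  have h3 := mul_rpow_le_integral_rpow hp (continuous_expSeries hb hs).norm
    (fun x => norm_nonneg _) hlt (c := 2 ^ (k + 2) * b (2 ^ (k + 2)) / (8 * π))
    (div_nonneg (mul_nonneg (by positivity) (hb _)) (by positivity)) (by
      refine le_trans (le_of_eq ?_) h
      rw [← e2, pow_succ, pow_succ]; field_simp; ring)
  refine le_trans (le_of_eq ?_) h3
  rw [condensedTerm, Real.div_rpow (mul_nonneg (by positivity) (hb _)) (by positivity), ← e2]
  have : (0:ℝ) < (8 * π) ^ p := by positivity
  rw [pow_succ, pow_succ]; field_simp; ring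

theorem sum_condensedTerm_le_integral {b : ℕ → ℝ} (hb : ∀ n, 0 ≤ b n) (hd : Antitone b)
    (hs : Summable b) {p : ℝ} (hp : 1 ≤ p) (K : ℕ) :
    2 * π / (8 * π) ^ p * ∑ k ∈ Finset.range K, condensedTerm p b (k + 2) ≤
      ∫ θ in (0:ℝ)..(2 * π), ‖expSeries b θ‖ ^ p := by
  have hc := continuous_norm_expSeries_rpow hb hs (p := p) (by linarith)
  have hπ := Real.pi_pos
  rw [Finset.mul_sum]
  refine (Finset.sum_le_sum fun k _ => condensedTerm_le_integral hb hd hs hp k).trans ?_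
  rw [sum_integral_dyadic hc]
  refine intervalIntegral.integral_mono_interval (by positivity) (div_le_self hπ.le
    (one_le_pow₀ one_le_two)) (by linarith) (Filter.Eventually.of_forall fun x => ?_)
    (hc.intervalIntegrable _ _)
  exact Real.rpow_nonneg (norm_nonneg _) p

theorem mul_le_sum_range {b : ℕ → ℝ} (hd : Antitone b) (N : ℕ) :
    N * b N ≤ ∑ n ∈ Finset.range N, b n := by
  have := Finset.card_nsmul_le_sum (Finset.range N) b (b N) fun n hn =>
    hd (Finset.mem_range.1 hn).le
  simpa using this

theorem integral_dyadic_le {b : ℕ → ℝ} (hb : ∀ n, 0 ≤ b n) (hd : Antitone b)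
    (hs : Summable b) {p : ℝ} (hp : 0 ≤ p) (k : ℕ) :
    ∫ θ in (π / 2 ^ (k + 1))..(π / 2 ^ k), ‖expSeries b θ‖ ^ p ≤
      π / 2 * 3 ^ p * ((∑ n ∈ Finset.range (2 ^ k), b n) ^ p / 2 ^ k) := by
  have hπ := Real.pi_pos
  have h2 : (0:ℝ) < 2 ^ k := by positivity
  have e2 : 2 * (π / 2 ^ (k + 1)) = π / 2 ^ k := by rw [pow_succ]; field_simp
  have hs0 : 0 < π / 2 ^ (k + 1) := by positivity
  set A := ∑ n ∈ Finset.range (2 ^ k), b n with hA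
  have hA0 : 0 ≤ A := Finset.sum_nonneg fun n _ => hb n
  have hle : π / 2 ^ (k + 1) ≤ π / 2 ^ k := by linarith
  have h := intervalIntegral.integral_mono_on (μ := MeasureTheory.volume) hle
    ((continuous_norm_expSeries_rpow hb hs hp).intervalIntegrable _ _)
    (continuous_const.intervalIntegrable _ _) (g := fun _ => (3 * A) ^ p) fun θ hθ => by
      have hθ0 : 0 < θ := hs0.trans_le hθ.1
      have h1 := norm_expSeries_le hb hd hs (2 ^ k) hθ0
        (hθ.2.trans (div_le_self hπ.le (one_le_pow₀ one_le_two)))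
      have h3 : π / θ ≤ 2 * 2 ^ k := by
        have := hθ.1
        rw [div_le_iff₀ (by positivity), pow_succ] at this
        rw [div_le_iff₀ hθ0]; linarith
      have h4 := mul_le_sum_range hd (2 ^ k)
      push_cast at h4
      refine Real.rpow_le_rpow (norm_nonneg _) ?_ hp
      have h5 := mul_le_mul_of_nonneg_right h3 (hb (2 ^ k))
      rw [← hA] at h1 h4
      linarith
  refine h.trans (le_of_eq ?_)
  rw [intervalIntegral.integral_const, smul_eq_mul, Real.mul_rpow (by norm_num) hA0, ← e2,
    pow_succ]
  field_simp; ring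

theorem integral_le_of_sum_le {b : ℕ → ℝ} (hb : ∀ n, 0 ≤ b n) (hd : Antitone b)
    (hs : Summable b) {p : ℝ} (hp : 0 ≤ p) {B : ℝ}
    (hB : ∀ K, ∑ k ∈ Finset.range K, (∑ n ∈ Finset.range (2 ^ k), b n) ^ p / 2 ^ k ≤ B) :
    ∫ θ in (0:ℝ)..(2 * π), ‖expSeries b θ‖ ^ p ≤ π * 3 ^ p * B := by
  have hc := continuous_norm_expSeries_rpow hb hs hp
  have hπ := Real.pi_pos
  have key : ∀ K : ℕ, ∫ θ in (π / 2 ^ K)..π, ‖expSeries b θ‖ ^ p ≤ π / 2 * 3 ^ p * B := by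
    intro K
    rw [← sum_integral_dyadic hc]
    refine (Finset.sum_le_sum fun k _ => integral_dyadic_le hb hd hs hp k).trans ?_
    rw [← Finset.mul_sum]
    exact mul_le_mul_of_nonneg_left (hB K) (by positivity)
  have hcont : Continuous fun x => ∫ θ in x..π, ‖expSeries b θ‖ ^ p := by
    simp_rw [intervalIntegral.integral_symm π]
    exact (intervalIntegral.continuous_primitive (fun _ _ => hc.intervalIntegrable _ _) π).neg
  have hl : Filter.Tendsto (fun K : ℕ => π / 2 ^ K) Filter.atTop (nhds 0) :=
    tendsto_const_nhds.div_atTop (tendsto_pow_atTop_atTop_of_one_lt one_lt_two)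
  have h := le_of_tendsto' ((hcont.tendsto 0).comp hl) key
  rw [integral_expSeries_eq_two_mul hb hs hp]
  linarith

/-- A quantitative form of convexity of `x ↦ x ^ p`. -/
theorem exists_add_rpow_le {p : ℝ} (hp : 1 ≤ p) : ∃ q C : ℝ, 0 ≤ q ∧ q < 1 ∧ 0 ≤ C ∧
    ∀ x y : ℝ, 0 ≤ x → 0 ≤ y → (x + y) ^ p / 2 ≤ q * x ^ p + C * y ^ p := by
  have hp0 : 0 < p := by linarith
  obtain ⟨q, hq⟩ : ∃ q : ℝ, q = (1 / 2 : ℝ) ^ (1 / p) := ⟨_, rfl⟩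
  have hq0 : 0 < q := hq ▸ by positivity
  have hq1 : q < 1 := hq ▸ Real.rpow_lt_one (by norm_num) (by norm_num) (by positivity)
  have hqp : q ^ p = 1 / 2 := by
    rw [hq, ← Real.rpow_mul (by norm_num), one_div_mul_cancel hp0.ne', Real.rpow_one]
  have hq' : 0 < 1 - q := sub_pos.2 hq1
  refine ⟨q, (1 - q) / (1 - q) ^ p / 2, hq0.le, hq1, by positivity, fun x y hx hy => ?_⟩
  have h := (convexOn_rpow hp).2 (x := x / q) (y := y / (1 - q)) (Set.mem_Ici.2 (by positivity))
    (Set.mem_Ici.2 (by positivity)) hq0.le hq'.le (by ring)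
  simp only [smul_eq_mul] at h
  rw [mul_div_cancel₀ _ hq0.ne', mul_div_cancel₀ _ hq'.ne', Real.div_rpow hx hq0.le,
    Real.div_rpow hy hq'.le, hqp] at h
  have e : (1 - q) / (1 - q) ^ p / 2 * y ^ p = (1 - q) * (y ^ p / (1 - q) ^ p) / 2 := by ring
  rw [e]
  linarith

/-- A discrete Hardy inequality over dyadic blocks. -/
theorem exists_sum_rpow_le {p : ℝ} (hp : 1 ≤ p) {b : ℕ → ℝ} (hb : ∀ n, 0 ≤ b n)
    (hd : Antitone b) (h : Summable (condensedTerm p b)) :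
    ∃ B, ∀ K, ∑ k ∈ Finset.range K, (∑ n ∈ Finset.range (2 ^ k), b n) ^ p / 2 ^ k ≤ B := by
  obtain ⟨q, C, hq0, hq1, hC, hadd⟩ := exists_add_rpow_le hp
  set A : ℕ → ℝ := fun k => ∑ n ∈ Finset.range (2 ^ k), b n
  have hA : ∀ k, 0 ≤ A k := fun k => Finset.sum_nonneg fun n _ => hb n
  have hstep : ∀ k, A (k + 1) ^ p / 2 ^ (k + 1) ≤
      q * (A k ^ p / 2 ^ k) + C * condensedTerm p b k := fun k => by
    have h1 : A (k + 1) ≤ A k + 2 ^ k * b (2 ^ k) := by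
      simp only [A]
      rw [pow_succ, mul_two, Finset.sum_range_add]
      have := Finset.sum_le_card_nsmul (Finset.range (2 ^ k)) (fun x => b (2 ^ k + x)) (b (2 ^ k))
        fun n _ => hd (Nat.le_add_right _ _)
      simp at this
      linarith
    have h2 : 0 ≤ 2 ^ k * b (2 ^ k) := mul_nonneg (by positivity) (hb _)
    have h3 := (Real.rpow_le_rpow (hA _) h1 (by linarith : 0 ≤ p))
    have h4 := hadd _ _ (hA k) h2
    have hk : (0:ℝ) < 2 ^ k := by positivity
    calc A (k + 1) ^ p / 2 ^ (k + 1) = A (k + 1) ^ p / 2 / 2 ^ k := by rw [pow_succ']; field_simp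
      _ ≤ (q * A k ^ p + C * (2 ^ k * b (2 ^ k)) ^ p) / 2 ^ k := by gcongr; linarith
      _ = _ := by rw [condensedTerm]; ring
  refine ⟨(A 0 ^ p + C * ∑' k, condensedTerm p b k) / (1 - q), fun K => ?_⟩
  rw [le_div_iff₀ (sub_pos.2 hq1)]
  have h1 : ∑ k ∈ Finset.range K, A k ^ p / 2 ^ k ≤
      ∑ k ∈ Finset.range (K + 1), A k ^ p / 2 ^ k := by
    rw [Finset.sum_range_succ]
    exact le_add_of_nonneg_right (div_nonneg (Real.rpow_nonneg (hA K) p) (by positivity))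
  rw [Finset.sum_range_succ'] at h1
  have h2 := Finset.sum_le_sum fun k (_ : k ∈ Finset.range K) => hstep k
  rw [Finset.sum_add_distrib, ← Finset.mul_sum, ← Finset.mul_sum] at h2
  have h3 := mul_le_mul_of_nonneg_left
    (h.sum_le_tsum (Finset.range K) fun k _ => condensedTerm_nonneg p hb k) hC
  rw [pow_zero, div_one] at h1
  linarith

theorem weight_bounds {p : ℝ} (hp : 0 ≤ p) {k n : ℕ} (hn : n ∈ Finset.Ico (2 ^ k) (2 ^ (k + 1))) :
    ((2:ℝ) ^ k) ^ p / (2 ^ (k + 1)) ^ 2 ≤ ((n:ℝ) + 1) ^ (p - 2) ∧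
      ((n:ℝ) + 1) ^ (p - 2) ≤ ((2:ℝ) ^ (k + 1)) ^ p / (2 ^ k) ^ 2 := by
  rw [Finset.mem_Ico] at hn
  have h1 : (2:ℝ) ^ k ≤ n + 1 := by exact_mod_cast hn.1.trans n.le_succ
  have h2 : (n:ℝ) + 1 ≤ 2 ^ (k + 1) := by exact_mod_cast hn.2
  have h0 : (0:ℝ) < n + 1 := by positivity
  rw [Real.rpow_sub h0, Real.rpow_two]
  constructor <;> gcongr

theorem sum_Ico_dyadic (g : ℕ → ℝ) (K : ℕ) :
    ∑ k ∈ Finset.range K, ∑ n ∈ Finset.Ico (2 ^ k) (2 ^ (k + 1)), g n =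
      ∑ n ∈ Finset.Ico 1 (2 ^ K), g n := by
  induction K with
  | zero => simp
  | succ K ih =>
    rw [Finset.sum_range_succ, ih, Finset.sum_Ico_consecutive _ Nat.one_le_two_pow
      (Nat.pow_le_pow_right two_pos K.le_succ)]

theorem card_Ico_dyadic (k : ℕ) : (Finset.Ico (2 ^ k) (2 ^ (k + 1))).card = 2 ^ k := by
  rw [Nat.card_Ico, pow_succ, mul_two, Nat.add_sub_cancel]

theorem sum_block_le {p : ℝ} (hp : 0 ≤ p) {b : ℕ → ℝ} (hb : ∀ n, 0 ≤ b n) (hd : Antitone b)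
    (k : ℕ) : ∑ n ∈ Finset.Ico (2 ^ k) (2 ^ (k + 1)), b n ^ p * ((n:ℝ) + 1) ^ (p - 2) ≤
      2 ^ p * condensedTerm p b k := by
  have h := Finset.sum_le_card_nsmul (Finset.Ico (2 ^ k) (2 ^ (k + 1)))
    (fun n => b n ^ p * ((n:ℝ) + 1) ^ (p - 2))
    (b (2 ^ k) ^ p * (((2:ℝ) ^ (k + 1)) ^ p / (2 ^ k) ^ 2)) fun n hn =>
      mul_le_mul (Real.rpow_le_rpow (hb n) (hd (Finset.mem_Ico.1 hn).1) hp)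
        (weight_bounds hp hn).2 (by positivity) (Real.rpow_nonneg (hb _) p)
  refine h.trans (le_of_eq ?_)
  rw [card_Ico_dyadic, nsmul_eq_mul, condensedTerm, Real.mul_rpow (by positivity) (hb _), pow_succ,
    Real.mul_rpow (by positivity) (by norm_num)]
  push_cast
  field_simp

theorem le_sum_block {p : ℝ} (hp : 0 ≤ p) {b : ℕ → ℝ} (hb : ∀ n, 0 ≤ b n) (hd : Antitone b)
    (k : ℕ) : condensedTerm p b (k + 1) ≤ 2 * 2 ^ p *
      ∑ n ∈ Finset.Ico (2 ^ k) (2 ^ (k + 1)), b n ^ p * ((n:ℝ) + 1) ^ (p - 2) := by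
  have h := Finset.card_nsmul_le_sum (Finset.Ico (2 ^ k) (2 ^ (k + 1)))
    (fun n => b n ^ p * ((n:ℝ) + 1) ^ (p - 2))
    (b (2 ^ (k + 1)) ^ p * (((2:ℝ) ^ k) ^ p / (2 ^ (k + 1)) ^ 2)) fun n hn =>
      mul_le_mul (Real.rpow_le_rpow (hb _) (hd (Finset.mem_Ico.1 hn).2.le) hp)
        (weight_bounds hp hn).1 (by positivity) (Real.rpow_nonneg (hb _) p)
  refine le_trans (le_of_eq ?_) (mul_le_mul_of_nonneg_left h (by positivity))
  rw [card_Ico_dyadic, nsmul_eq_mul, condensedTerm, Real.mul_rpow (by positivity) (hb _),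
    pow_succ (2:ℝ) k, Real.mul_rpow (by positivity) (by norm_num)]
  push_cast
  field_simp

theorem summable_condensedTerm_iff {p : ℝ} (hp : 0 ≤ p) {b : ℕ → ℝ} (hb : ∀ n, 0 ≤ b n)
    (hd : Antitone b) : Summable (condensedTerm p b) ↔
      Summable fun n : ℕ => b n ^ p * ((n:ℝ) + 1) ^ (p - 2) := by
  set g := fun n : ℕ => b n ^ p * ((n:ℝ) + 1) ^ (p - 2)
  have hg : ∀ n, 0 ≤ g n := fun n => mul_nonneg (Real.rpow_nonneg (hb n) p) (by positivity)
  constructor <;> intro h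
  · rw [← summable_nat_add_iff 1]
    refine summable_of_sum_range_le (c := 2 ^ p * ∑' k, condensedTerm p b k)
      (fun n => hg _) fun N => ?_
    calc ∑ n ∈ Finset.range N, g (n + 1) = ∑ n ∈ Finset.Ico 1 (N + 1), g n := by
          rw [Finset.sum_Ico_eq_sum_range]; simp [add_comm]
      _ ≤ ∑ n ∈ Finset.Ico 1 (2 ^ N), g n := Finset.sum_le_sum_of_subset_of_nonneg
          (Finset.Ico_subset_Ico_right Nat.lt_two_pow_self) fun n _ _ => hg n
      _ ≤ ∑ k ∈ Finset.range N, 2 ^ p * condensedTerm p b k := by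
          rw [← sum_Ico_dyadic]
          exact Finset.sum_le_sum fun k _ => sum_block_le hp hb hd k
      _ ≤ _ := by
          rw [← Finset.mul_sum]
          exact mul_le_mul_of_nonneg_left
            (h.sum_le_tsum _ fun k _ => condensedTerm_nonneg p hb k) (by positivity)
  · rw [← summable_nat_add_iff 1]
    refine summable_of_sum_range_le (c := 2 * 2 ^ p * ∑' n, g n)
      (fun n => condensedTerm_nonneg p hb _) fun N => ?_
    refine (Finset.sum_le_sum fun k _ => le_sum_block hp hb hd k).trans ?_
    rw [← Finset.mul_sum, sum_Ico_dyadic]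
    exact mul_le_mul_of_nonneg_left (h.sum_le_tsum _ fun n _ => hg n) (by positivity)

/-- For a power series with nonnegative coefficients decreasing to zero and `1 ≤ p < ∞`,
membership in the Hardy space `H^p` is equivalent to `Σ aₙ^p (n+1)^{p-2} < ∞`. -/
theorem hardy_iff_HL_of_decreasing_coeffs (p : ℝ) (hp : 1 ≤ p)
    (a : ℕ → ℝ) (hpos : ∀ n, 0 ≤ a n) (hdec : Antitone a)
    (hlim : Filter.Tendsto a Filter.atTop (nhds 0)) :
    (∃ C : ℝ, ∀ r : ℝ, 0 < r → r < 1 →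
        (1 / (2 * Real.pi)) * ∫ θ in (0:ℝ)..(2 * Real.pi),
          ‖∑' n : ℕ, (a n : ℂ) * ((r : ℂ) * Complex.exp (Complex.I * θ)) ^ n‖ ^ p ≤ C) ↔
      Summable (fun n : ℕ => a n ^ p * ((n : ℝ) + 1) ^ (p - 2)) := by
  have hp0 : 0 ≤ p := by linarith
  have hπ := Real.pi_pos
  rw [← summable_condensedTerm_iff hp0 hpos hdec]
  have hf : ∀ (r θ : ℝ), ∑' n : ℕ, (a n : ℂ) * ((r : ℂ) * Complex.exp (Complex.I * θ)) ^ n =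
      expSeries (fun n => a n * r ^ n) θ := fun r θ => by
    refine tsum_congr fun n => ?_
    push_cast
    rw [mul_pow, mul_assoc]
  simp only [hf]
  have hb : ∀ r : ℝ, 0 < r → ∀ n, 0 ≤ a n * r ^ n := fun r hr n =>
    mul_nonneg (hpos n) (by positivity)
  have hd : ∀ r : ℝ, 0 < r → r < 1 → Antitone fun n => a n * r ^ n := fun r h0 h1 m n hmn =>
    mul_le_mul (hdec hmn) (pow_le_pow_of_le_one h0.le h1.le hmn) (by positivity) (hpos m)
  have hs : ∀ r : ℝ, 0 < r → r < 1 → Summable fun n => a n * r ^ n := fun r h0 h1 =>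
    Summable.of_nonneg_of_le (hb r h0)
      (fun n => mul_le_mul_of_nonneg_right (hdec n.zero_le) (by positivity))
      ((summable_geometric_of_lt_one h0.le h1).mul_left (a 0))
  constructor
  · rintro ⟨C, hC⟩
    rw [← summable_nat_add_iff 2]
    have hc : 0 < 2 * π / (8 * π) ^ p := by positivity
    refine summable_of_sum_range_le (c := 2 * π * C / (2 * π / (8 * π) ^ p))
      (fun k => condensedTerm_nonneg p hpos _) fun K => ?_
    have hle : ∀ r : ℝ, 0 < r → r < 1 →
        ∑ k ∈ Finset.range K, condensedTerm p (fun n => a n * r ^ n) (k + 2) ≤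
          2 * π * C / (2 * π / (8 * π) ^ p) := fun r h0 h1 => by
      have h := hC r h0 h1
      rw [one_div, inv_mul_le_iff₀ (by positivity)] at h
      rw [le_div_iff₀' hc]
      exact (sum_condensedTerm_le_integral (hb r h0) (hd r h0 h1) (hs r h0 h1) hp K).trans h
    have hcont : Continuous fun r : ℝ =>
        ∑ k ∈ Finset.range K, condensedTerm p (fun n => a n * r ^ n) (k + 2) := by
      unfold condensedTerm
      refine continuous_finsetSum _ fun k _ => Continuous.div_const ?_ _
      exact (by fun_prop : Continuous _).rpow_const fun _ => Or.inr hp0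
    have ht := (hcont.tendsto 1).mono_left (nhdsWithin_le_nhds (s := Set.Iio 1))
    simp only [one_pow, mul_one] at ht
    refine le_of_tendsto ht ?_
    filter_upwards [Ioo_mem_nhdsLT (zero_lt_one (α := ℝ))] with r hr
    exact hle r hr.1 hr.2
  · intro h
    obtain ⟨B, hB⟩ := exists_sum_rpow_le hp hpos hdec h
    refine ⟨1 / (2 * π) * (π * 3 ^ p * B), fun r h0 h1 => ?_⟩
    refine mul_le_mul_of_nonneg_left ?_ (by positivity)
    refine integral_le_of_sum_le (hb r h0) (hd r h0 h1) (hs r h0 h1) hp0 fun K => ?_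
    refine le_trans (Finset.sum_le_sum fun k _ => ?_) (hB K)
    refine div_le_div_of_nonneg_right (Real.rpow_le_rpow (Finset.sum_nonneg fun n _ => hb r h0 n)
      (Finset.sum_le_sum fun n _ => ?_) hp0) (by positivity)
    exact mul_le_of_le_one_right (hpos n) (pow_le_one₀ h0.le h1.le)
end

section
/- For 1 ≤ r < 1 real with 1/2 ≤ r < 1, we have Σ_{n≥2} 2^n r^{2^{n-1}} ≤ C/(1-r) for an absolute constant C > 0. -/
/-- Cauchy condensation for the geometric series: partial sums are dominated blockwise. -/
theorem sum_range_two_pow_mul_pow_le {r : ℝ} (h0 : 0 ≤ r) (h1 : r ≤ 1) (N : ℕ) :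
    ∑ n ∈ Finset.range N, (2 : ℝ) ^ (n + 2) * r ^ (2 ^ (n + 1)) ≤
      4 * ∑ k ∈ Finset.range (2 ^ N), r ^ k := by
  induction N with
  | zero => simp
  | succ N ih =>
    have block : (2 : ℝ) ^ N * r ^ (2 ^ (N + 1)) ≤
        ∑ k ∈ Finset.range (2 ^ N), r ^ (2 ^ N + k) := by
      have h := Finset.card_nsmul_le_sum (Finset.range (2 ^ N)) (fun k => r ^ (2 ^ N + k))
        (r ^ (2 ^ (N + 1))) fun k hk => pow_le_pow_of_le_one h0 h1 (by
          have := Finset.mem_range.1 hk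
          rw [pow_succ]
          omega)
      simpa using h
    rw [pow_succ, mul_two] at block
    rw [Finset.sum_range_succ, pow_succ 2 N, mul_two, Finset.sum_range_add, pow_add 2 N 2]
    linarith

/-- `Σ_{n≥2} 2ⁿ r^{2^{n-1}} ≤ C/(1-r)` for `r ∈ [1/2,1)`, with an absolute constant. -/
theorem sum_dyadic_pow_le :
    ∃ C : ℝ, 0 < C ∧ ∀ r : ℝ, 1 / 2 ≤ r → r < 1 →
      (∑' n : ℕ, (2 : ℝ) ^ (n + 2) * r ^ (2 ^ (n + 1))) ≤ C / (1 - r) := by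
  refine ⟨4, by norm_num, fun r hr h1 => ?_⟩
  have h0 : 0 ≤ r := by linarith
  refine Real.tsum_le_of_sum_range_le (fun n => by positivity) fun N => ?_
  refine (sum_range_two_pow_mul_pow_le h0 h1.le N).trans ?_
  rw [div_eq_mul_inv, ← tsum_geometric_of_lt_one h0 h1]
  gcongr
  exact (summable_geometric_of_lt_one h0 h1).sum_le_tsum _ fun k _ => by positivity
end

section
/- Let 0 < p ≤ 1. If f is analytic on the unit disc with f' ∈ L^1 of the measure (1-|z|)^{1/p - 1} dA(z) (i.e. f ∈ D^p_{p-1}-type integrability with exponent 1) and g is analytic with sup_{z∈𝔻} |g'(z)|(1-|z|²)² < ∞, then |∫_𝔻 f(z) conj(g(z)) (1-|z|²)^{1/p-1} dA(z)| ≤ C ‖g‖_{ℬ²} (∫_𝔻 |f'(ζ)|(1-|ζ|)^{1/p-1} dA(ζ) + |f(0)|) for some constant C = C(p), where ‖g‖_{ℬ²} = sup_z |g'(z)|(1-|z|²)² + |g(0)|. -/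
open Real Complex MeasureTheory

theorem continuous_mul_radial {u : ℂ → ℂ} {ψ : ℝ → ℝ} {s : ℝ}
    (hu : ContinuousOn u (Metric.ball 0 1)) (hψ : Continuous ψ) (hs : s < 1)
    (hψs : ∀ t, s ≤ t → ψ t = 0) :
    Continuous fun z : ℂ => u z * (ψ (‖z‖ ^ 2) : ℂ) := by
  rw [continuous_iff_continuousAt]
  intro z
  by_cases hz : ‖z‖ < 1
  · have h1 : ContinuousAt u z :=
      hu.continuousAt (Metric.isOpen_ball.mem_nhds (by simpa using hz))
    exact h1.mul (by fun_prop)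
  · have h1 : ∀ᶠ y : ℂ in nhds z, s < ‖y‖ ^ 2 := by
      have hc : Continuous fun y : ℂ => ‖y‖ ^ 2 := by fun_prop
      exact hc.continuousAt.eventually (lt_mem_nhds (by nlinarith))
    refine (continuousAt_const (y := (0 : ℂ))).congr ?_
    filter_upwards [h1] with y hy
    simp [hψs _ hy.le]

theorem integrable_mul_radial {u : ℂ → ℂ} {ψ : ℝ → ℝ} {s : ℝ}
    (hu : ContinuousOn u (Metric.ball 0 1)) (hψ : Continuous ψ) (hs : s < 1)
    (hψs : ∀ t, s ≤ t → ψ t = 0) :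
    Integrable fun z : ℂ => u z * (ψ (‖z‖ ^ 2) : ℂ) := by
  refine (continuous_mul_radial hu hψ hs hψs).integrable_of_hasCompactSupport
    (HasCompactSupport.intro (isCompact_closedBall (0 : ℂ) 1) fun z hz => ?_)
  have hz' : 1 < ‖z‖ := by simpa using hz
  simp [hψs (‖z‖ ^ 2) (by nlinarith)]

theorem integral_lineDeriv_eq_zero {F F' : ℂ → ℂ} {v : ℂ} (hF : Integrable F)
    (hF' : Integrable F') (h : ∀ z, HasLineDerivAt ℝ F (F' z) z v) : ∫ z, F' z = 0 := by
  have := integral_bilinear_hasLineDerivAt_right_eq_neg_left_of_integrable (μ := volume)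
    (B := ContinuousLinearMap.mul ℝ ℂ) (f := F) (f' := F') (g := fun _ => 1) (g' := fun _ => 0)
    (v := v) (by simpa using hF') (by simp) (by simpa using hF) (fun x _ => h x)
    (fun x _ => by simpa [HasLineDerivAt] using hasDerivAt_const (0 : ℝ) (1 : ℂ))
  simpa using this

theorem hasLineDerivAt_mul_conj_mul_radial {f h : ℂ → ℂ} {w Φ : ℝ → ℝ} {s : ℝ}
    (hf : DifferentiableOn ℂ f (Metric.ball 0 1)) (hh : DifferentiableOn ℂ h (Metric.ball 0 1))
    (hs : s < 1) (hws : ∀ t, s ≤ t → w t = 0) (hΦs : ∀ t, s ≤ t → Φ t = 0)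
    (hΦ : ∀ t, HasDerivAt Φ (-w t) t) (v z : ℂ) :
    HasLineDerivAt ℝ (fun z => f z * (starRingEnd ℂ) (h z) * (Φ (‖z‖ ^ 2) : ℂ))
      (v * (deriv f z * (starRingEnd ℂ) (h z) * (Φ (‖z‖ ^ 2) : ℂ)) +
        (starRingEnd ℂ) v * (f z * (starRingEnd ℂ) (deriv h z) * (Φ (‖z‖ ^ 2) : ℂ)) -
        2 * (f z * (starRingEnd ℂ) (h z) * ((z.re * v.re + z.im * v.im : ℝ) : ℂ) *
          (w (‖z‖ ^ 2) : ℂ))) z v := by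
  unfold HasLineDerivAt
  have hline : HasDerivAt (fun t : ℝ => z + t • v) v 0 := by
    simpa using ((hasDerivAt_id (0 : ℝ)).smul_const v).const_add z
  by_cases hz : ‖z‖ < 1
  · have hmem : Metric.ball (0 : ℂ) 1 ∈ nhds z := Metric.isOpen_ball.mem_nhds (by simpa using hz)
    have h1 : HasDerivAt (fun t : ℝ => f (z + t • v)) (deriv f z * v) 0 :=
      HasDerivAt.comp_of_eq (0 : ℝ) (hf.differentiableAt hmem).hasDerivAt hline (by simp)
    have h2 : HasDerivAt (fun t : ℝ => h (z + t • v)) (deriv h z * v) 0 :=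
      HasDerivAt.comp_of_eq (0 : ℝ) (hh.differentiableAt hmem).hasDerivAt hline (by simp)
    have h3 : HasDerivAt (fun t : ℝ => (starRingEnd ℂ) (h (z + t • v)))
        ((starRingEnd ℂ) (deriv h z * v)) 0 := h2.star
    have h4 : HasDerivAt (fun t : ℝ => ‖z + t • v‖ ^ 2) (2 * (z.re * v.re + z.im * v.im)) 0 := by
      have := hline.norm_sq
      simpa [Complex.inner, mul_comm] using this
    have h5 : HasDerivAt (fun t : ℝ => Φ (‖z + t • v‖ ^ 2))
        (-w (‖z‖ ^ 2) * (2 * (z.re * v.re + z.im * v.im))) 0 :=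
      HasDerivAt.comp_of_eq (0 : ℝ) (hΦ _) h4 (by simp)
    refine ((h1.mul h3).mul h5.ofReal_comp).congr_deriv ?_
    simp only [Pi.mul_apply, zero_smul, add_zero, map_mul]
    push_cast
    ring
  · have hz1 : s ≤ ‖z‖ ^ 2 := by nlinarith
    have hd : HasDerivAt (fun _ : ℝ => (0 : ℂ)) 0 0 := hasDerivAt_const ..
    simp only [hws _ hz1, hΦs _ hz1, ofReal_zero, mul_zero, add_zero, sub_zero]
    refine hd.congr_of_eventuallyEq ?_
    have hc : Continuous fun t : ℝ => ‖z + t • v‖ ^ 2 := by fun_prop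
    have h1 : ∀ᶠ t : ℝ in nhds 0, s < ‖z + t • v‖ ^ 2 :=
      hc.continuousAt.eventually (lt_mem_nhds (by simp; nlinarith))
    filter_upwards [h1] with t ht
    rw [hΦs _ ht.le, ofReal_zero, mul_zero]

/-- Green's formula on the disc for radial weights: `-w` is the derivative of `Φ`. -/
theorem integral_mul_conj_mul_radial {f h : ℂ → ℂ} {w Φ : ℝ → ℝ} {s : ℝ}
    (hf : DifferentiableOn ℂ f (Metric.ball 0 1)) (hh : DifferentiableOn ℂ h (Metric.ball 0 1))
    (hs : s < 1) (hw : Continuous w) (hws : ∀ t, s ≤ t → w t = 0)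
    (hΦs : ∀ t, s ≤ t → Φ t = 0) (hΦ : ∀ t, HasDerivAt Φ (-w t) t) :
    ∫ z : ℂ, f z * (starRingEnd ℂ) (z * h z) * (w (‖z‖ ^ 2) : ℂ) =
      ∫ z : ℂ, deriv f z * (starRingEnd ℂ) (h z) * (Φ (‖z‖ ^ 2) : ℂ) := by
  have hf' := (hf.deriv Metric.isOpen_ball).continuousOn
  have hh' := (hh.deriv Metric.isOpen_ball).continuousOn
  have cf := hf.continuousOn
  have ch := hh.continuousOn
  have hΦc : Continuous Φ := continuous_iff_continuousAt.2 fun t => (hΦ t).continuousAt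
  have cc : ∀ {u : ℂ → ℂ}, ContinuousOn u (Metric.ball 0 1) →
      ContinuousOn (fun z => (starRingEnd ℂ) (u z)) (Metric.ball 0 1) :=
    fun hu => continuous_conj.comp_continuousOn hu
  have iF : Integrable fun z : ℂ => f z * (starRingEnd ℂ) (h z) * (Φ (‖z‖ ^ 2) : ℂ) :=
    integrable_mul_radial (cf.mul (cc ch)) hΦc hs hΦs
  have iP : Integrable fun z : ℂ =>
      deriv f z * (starRingEnd ℂ) (h z) * (Φ (‖z‖ ^ 2) : ℂ) :=
    integrable_mul_radial (hf'.mul (cc ch)) hΦc hs hΦs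
  have iQ : Integrable fun z : ℂ =>
      f z * (starRingEnd ℂ) (deriv h z) * (Φ (‖z‖ ^ 2) : ℂ) :=
    integrable_mul_radial (cf.mul (cc hh')) hΦc hs hΦs
  have iR : ∀ v : ℂ, Integrable fun z : ℂ => f z * (starRingEnd ℂ) (h z) *
      ((z.re * v.re + z.im * v.im : ℝ) : ℂ) * (w (‖z‖ ^ 2) : ℂ) := fun v =>
    integrable_mul_radial ((cf.mul (cc ch)).mul (by fun_prop)) hw hs hws
  have key : ∀ v : ℂ, v * ∫ z, deriv f z * (starRingEnd ℂ) (h z) * (Φ (‖z‖ ^ 2) : ℂ)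
      = 2 * (∫ z : ℂ, f z * (starRingEnd ℂ) (h z) *
        ((z.re * v.re + z.im * v.im : ℝ) : ℂ) * (w (‖z‖ ^ 2) : ℂ)) -
        (starRingEnd ℂ) v * ∫ z, f z * (starRingEnd ℂ) (deriv h z) * (Φ (‖z‖ ^ 2) : ℂ) := by
    intro v
    have e := integral_lineDeriv_eq_zero iF
      (((iP.const_mul v).add (iQ.const_mul ((starRingEnd ℂ) v))).sub ((iR v).const_mul 2))
      (hasLineDerivAt_mul_conj_mul_radial hf hh hs hws hΦs hΦ v)
    rw [integral_sub' ((iP.const_mul v).add (iQ.const_mul _)) ((iR v).const_mul 2),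
      integral_add' (iP.const_mul v) (iQ.const_mul _)] at e
    simp only [integral_const_mul] at e
    linear_combination e
  have k1 := key 1
  have k2 := key I
  have hsum : ∫ z : ℂ, f z * (starRingEnd ℂ) (z * h z) * (w (‖z‖ ^ 2) : ℂ) =
      (∫ z : ℂ, f z * (starRingEnd ℂ) (h z) *
        ((z.re * (1 : ℂ).re + z.im * (1 : ℂ).im : ℝ) : ℂ) * (w (‖z‖ ^ 2) : ℂ)) -
      I * (∫ z : ℂ, f z * (starRingEnd ℂ) (h z) *
        ((z.re * I.re + z.im * I.im : ℝ) : ℂ) * (w (‖z‖ ^ 2) : ℂ)) := by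
    rw [← integral_const_mul, ← integral_sub (iR 1) ((iR I).const_mul _)]
    congr 1
    ext z
    have hz : (starRingEnd ℂ) z = z.re - I * z.im := by
      apply Complex.ext <;> simp
    simp only [map_mul, hz, one_re, one_im, I_re, I_im]
    push_cast
    ring
  rw [hsum]
  simp only [conj_I, map_one] at k1 k2
  linear_combination (-1 / 2 : ℂ) * k1 + (I / 2) * k2 +
    ((∫ z : ℂ, f z * (starRingEnd ℂ) (deriv h z) * (Φ (‖z‖ ^ 2) : ℂ)) -
      ∫ z : ℂ, deriv f z * (starRingEnd ℂ) (h z) * (Φ (‖z‖ ^ 2) : ℂ)) / 2 * I_sq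

theorem norm_dslope_zero_le {g : ℂ → ℂ} (hg : DifferentiableOn ℂ g (Metric.ball 0 1)) {B : ℝ}
    (hB : ∀ z : ℂ, ‖z‖ < 1 → ‖deriv g z‖ * (1 - ‖z‖ ^ 2) ^ 2 ≤ B) {z : ℂ} (hz : ‖z‖ < 1) :
    ‖dslope g 0 z‖ ≤ B / (1 - ‖z‖) := by
  have hB0 : 0 ≤ B := le_trans (by positivity) (hB 0 (by simp))
  have h1z : 0 < 1 - ‖z‖ := by linarith
  rcases eq_or_ne z 0 with rfl | hz0
  · simpa using hB 0 (by simp)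
  have hr : 0 < ‖z‖ := norm_pos_iff.2 hz0
  have hlt : ∀ t ∈ Set.Icc (0 : ℝ) 1, 0 < 1 - t * ‖z‖ := fun t ht => by
    nlinarith [ht.1, ht.2]
  have hlt' : ∀ t ∈ Set.Icc (0 : ℝ) 1, ‖(t : ℂ) * z‖ < 1 := fun t ht => by
    rw [norm_mul, norm_real, Real.norm_of_nonneg ht.1]
    linarith [hlt t ht]
  have hd : ∀ t ∈ Set.Icc (0 : ℝ) 1,
      HasDerivAt (fun t : ℝ => g (t * z) - g 0) (deriv g (t * z) * z) t := fun t ht => by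
    have hm : Metric.ball (0 : ℂ) 1 ∈ nhds ((t : ℂ) * z) :=
      Metric.isOpen_ball.mem_nhds (by simpa using hlt' t ht)
    have hl : HasDerivAt (fun t : ℝ => (t : ℂ) * z) z t := by
      simpa using (hasDerivAt_id t).ofReal_comp.mul_const z
    exact (HasDerivAt.comp_of_eq t (hg.differentiableAt hm).hasDerivAt hl rfl).sub_const _
  have hb : ∀ t ∈ Set.Icc (0 : ℝ) 1, HasDerivAt (fun t : ℝ => B * ((1 - t * ‖z‖)⁻¹ - 1))
      (B * (‖z‖ / (1 - t * ‖z‖) ^ 2)) t := fun t ht => by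
    have h1 : HasDerivAt (fun t : ℝ => 1 - t * ‖z‖) (-‖z‖) t := by
      simpa using ((hasDerivAt_id t).mul_const ‖z‖).const_sub 1
    simpa using ((h1.inv (hlt t ht).ne').sub_const 1).const_mul B
  have main := image_norm_le_of_norm_deriv_right_le_deriv_boundary'
    (f := fun t : ℝ => g (t * z) - g 0) (f' := fun t => deriv g (t * z) * z) (a := 0) (b := 1)
    (B := fun t : ℝ => B * ((1 - t * ‖z‖)⁻¹ - 1)) (B' := fun t => B * (‖z‖ / (1 - t * ‖z‖) ^ 2))
    (fun t ht => (hd t ht).continuousAt.continuousWithinAt)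
    (fun t ht => (hd t (Set.Ico_subset_Icc_self ht)).hasDerivWithinAt) (by simp)
    (fun t ht => (hb t ht).continuousAt.continuousWithinAt)
    (fun t ht => (hb t (Set.Ico_subset_Icc_self ht)).hasDerivWithinAt)
    (fun t ht => by
      have ht' := Set.Ico_subset_Icc_self ht
      have h1 := hlt t ht'
      have h2 := hB _ (hlt' t ht')
      rw [norm_mul (t : ℂ) z, norm_real, Real.norm_of_nonneg ht.1] at h2
      have h3 : (1 - t * ‖z‖) ^ 2 ≤ (1 - (t * ‖z‖) ^ 2) ^ 2 := by
        have : 0 ≤ t * ‖z‖ := mul_nonneg ht.1 hr.le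
        gcongr
        nlinarith
      rw [norm_mul, mul_div_assoc', le_div_iff₀ (by positivity), mul_right_comm]
      refine mul_le_mul_of_nonneg_right (le_trans ?_ h2) hr.le
      gcongr)
    (Set.right_mem_Icc.2 zero_le_one)
  rw [dslope_of_ne _ hz0, slope_def_field, norm_div, sub_zero, div_le_iff₀ hr]
  simp only [ofReal_one, one_mul] at main
  refine main.trans_eq ?_
  field_simp
  ring

theorem norm_integral_mul_conj_mul_radial_le {f g : ℂ → ℂ} {w : ℝ → ℝ} {s α B : ℝ}
    (hα : 0 ≤ α) (hf : DifferentiableOn ℂ f (Metric.ball 0 1))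
    (hg : DifferentiableOn ℂ g (Metric.ball 0 1))
    (hfi : IntegrableOn (fun z : ℂ => ‖deriv f z‖ * (1 - ‖z‖) ^ α) (Metric.ball (0 : ℂ) 1))
    (hB : ∀ z : ℂ, ‖z‖ < 1 → ‖deriv g z‖ * (1 - ‖z‖ ^ 2) ^ 2 ≤ B)
    (hs : s < 1) (hw : Continuous w) (hws : ∀ t, s ≤ t → w t = 0)
    (hw0 : ∀ t, 0 ≤ w t) (hw1 : ∀ t < 1, w t ≤ (1 - t) ^ α) :
    ‖∫ z : ℂ, f z * (starRingEnd ℂ) (g z) * (w (‖z‖ ^ 2) : ℂ)‖ ≤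
      2 ^ (α + 1) * B * (∫ z in Metric.ball (0 : ℂ) 1, ‖deriv f z‖ * (1 - ‖z‖) ^ α) +
        volume.real (Metric.ball (0 : ℂ) 1) * ‖f 0‖ * ‖g 0‖ := by
  have hB0 : 0 ≤ B := le_trans (by positivity) (hB 0 (by simp))
  set Φ : ℝ → ℝ := fun t => ∫ x in t..1, w x
  have hΦs : ∀ t, s ≤ t → Φ t = 0 := fun t ht => by
    refine (intervalIntegral.integral_congr (g := fun _ => (0 : ℝ)) fun x hx => ?_).trans (by simp)
    exact hws x ((le_min ht hs.le).trans hx.1)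
  have hΦ : ∀ t, HasDerivAt Φ (-w t) t := fun t =>
    intervalIntegral.integral_hasDerivAt_left (hw.intervalIntegrable _ _)
      hw.stronglyMeasurable.stronglyMeasurableAtFilter hw.continuousAt
  have hΦle : ∀ t < 1, |Φ t| ≤ (1 - t) ^ α * (1 - t) := fun t ht => by
    have := intervalIntegral.norm_integral_le_of_norm_le_const (a := t) (b := 1) (f := w)
      (C := (1 - t) ^ α) fun x hx => by
        rw [Set.uIoc_of_le ht.le] at hx
        rw [Real.norm_of_nonneg (hw0 x)]
        rcases hx.2.lt_or_eq with h | rfl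
        · exact (hw1 x h).trans (Real.rpow_le_rpow (by linarith) (by linarith [hx.1]) hα)
        · rw [hws 1 hs.le]
          exact Real.rpow_nonneg (by linarith) _
    rwa [abs_of_pos (by linarith : (0 : ℝ) < 1 - t)] at this
  have hnhds : Metric.ball (0 : ℂ) 1 ∈ nhds 0 := Metric.ball_mem_nhds _ one_pos
  have hdf := (differentiableOn_dslope hnhds).2 hf
  have hdg := (differentiableOn_dslope hnhds).2 hg
  have hfd : ∀ z, z * dslope f 0 z = f z - f 0 := fun z => by
    simpa using sub_smul_dslope f 0 z
  have hgd : ∀ z, z * dslope g 0 z = g z - g 0 := fun z => by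
    simpa using sub_smul_dslope g 0 z
  have cc : ∀ {u : ℂ → ℂ}, ContinuousOn u (Metric.ball 0 1) →
      ContinuousOn (fun z => (starRingEnd ℂ) (u z)) (Metric.ball 0 1) :=
    fun hu => continuous_conj.comp_continuousOn hu
  have green := integral_mul_conj_mul_radial hf hdg hs hw hws hΦs hΦ
  have mean : ∫ z : ℂ, f z * (w (‖z‖ ^ 2) : ℂ) = f 0 * ∫ z : ℂ, (w (‖z‖ ^ 2) : ℂ) := by
    have e := integral_mul_conj_mul_radial (f := fun _ => 1) (differentiableOn_const 1)
      hdf hs hw hws hΦs hΦ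
    simp only [hfd, deriv_const, one_mul, zero_mul, integral_zero] at e
    have e' := congrArg (starRingEnd ℂ) e
    rw [← integral_conj] at e'
    simp only [map_mul, conj_conj, conj_ofReal, map_zero, sub_mul] at e'
    rw [integral_sub (integrable_mul_radial hf.continuousOn hw hs hws)
      (integrable_mul_radial continuousOn_const hw hs hws), integral_const_mul] at e'
    exact sub_eq_zero.1 e'
  have split : ∫ z : ℂ, f z * (starRingEnd ℂ) (g z) * (w (‖z‖ ^ 2) : ℂ) =
      (∫ z : ℂ, deriv f z * (starRingEnd ℂ) (dslope g 0 z) * (Φ (‖z‖ ^ 2) : ℂ)) +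
        (∫ z : ℂ, (w (‖z‖ ^ 2) : ℂ)) * f 0 * (starRingEnd ℂ) (g 0) := by
    rw [← green, mul_comm (∫ z : ℂ, (w (‖z‖ ^ 2) : ℂ)), ← mean, ← integral_mul_const,
      ← integral_add]
    · congr 1
      ext z
      rw [hgd, map_sub]
      ring
    · exact integrable_mul_radial
        (hf.continuousOn.mul (cc (continuousOn_id.mul hdg.continuousOn))) hw hs hws
    · exact (integrable_mul_radial hf.continuousOn hw hs hws).mul_const _
  have hout : ∀ z ∉ Metric.ball (0 : ℂ) 1, s ≤ ‖z‖ ^ 2 := fun z hz => by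
    have : 1 ≤ ‖z‖ := by simpa using hz
    nlinarith
  have bound₁ : ‖∫ z : ℂ, deriv f z * (starRingEnd ℂ) (dslope g 0 z) * (Φ (‖z‖ ^ 2) : ℂ)‖ ≤
      2 ^ (α + 1) * B * (∫ z in Metric.ball (0 : ℂ) 1, ‖deriv f z‖ * (1 - ‖z‖) ^ α) := by
    rw [← setIntegral_eq_integral_of_forall_compl_eq_zero (s := Metric.ball (0 : ℂ) 1)
      (fun z hz => by rw [hΦs _ (hout z hz), ofReal_zero, mul_zero]), ← integral_const_mul]
    refine norm_integral_le_of_norm_le (hfi.const_mul _) ?_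
    filter_upwards [ae_restrict_mem measurableSet_ball] with z hz
    have hz' : ‖z‖ < 1 := by simpa using hz
    have h1 : 0 < 1 - ‖z‖ := by linarith
    have h2 : 1 - ‖z‖ ^ 2 ≤ 2 * (1 - ‖z‖) := by nlinarith
    have h3 : 0 < 1 - ‖z‖ ^ 2 := by nlinarith [norm_nonneg z]
    have h4 : |Φ (‖z‖ ^ 2)| ≤ (2 * (1 - ‖z‖)) ^ α * (2 * (1 - ‖z‖)) :=
      (hΦle _ (by linarith)).trans (by gcongr)
    rw [norm_mul, norm_mul, RCLike.norm_conj, norm_real, Real.norm_eq_abs]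
    calc ‖deriv f z‖ * ‖dslope g 0 z‖ * |Φ (‖z‖ ^ 2)|
        ≤ ‖deriv f z‖ * (B / (1 - ‖z‖)) * ((2 * (1 - ‖z‖)) ^ α * (2 * (1 - ‖z‖))) := by
          gcongr
          exact norm_dslope_zero_le hg hB hz'
      _ = 2 ^ (α + 1) * B * (‖deriv f z‖ * (1 - ‖z‖) ^ α) := by
          rw [Real.mul_rpow (by norm_num) h1.le, Real.rpow_add_one (by norm_num)]
          field_simp
  have bound₂ : ‖∫ z : ℂ, (w (‖z‖ ^ 2) : ℂ)‖ ≤ volume.real (Metric.ball (0 : ℂ) 1) := by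
    rw [← setIntegral_eq_integral_of_forall_compl_eq_zero (s := Metric.ball (0 : ℂ) 1)
      (fun z hz => by rw [hws _ (hout z hz), ofReal_zero])]
    refine (norm_setIntegral_le_of_norm_le_const (C := 1) measure_ball_lt_top
      fun z hz => ?_).trans_eq (one_mul _)
    have hz' : ‖z‖ < 1 := by simpa using hz
    rw [norm_real, Real.norm_of_nonneg (hw0 _)]
    exact (hw1 _ (by nlinarith [norm_nonneg z])).trans
      (Real.rpow_le_one (by nlinarith [norm_nonneg z]) (by nlinarith [norm_nonneg z]) hα)
  rw [split]
  refine (norm_add_le _ _).trans (add_le_add bound₁ ?_)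
  rw [norm_mul, norm_mul, RCLike.norm_conj]
  gcongr

/-- The easy half of the duality `(D^p_{p-1})^⋆ ≃ ℬ²` for `0 < p ≤ 1`: every `g ∈ ℬ²`
induces a bounded linear functional on `D^p_{p-1}` via the `A²_{1/p-1}`-pairing. -/
theorem Bloch2_functional_on_Dirichlet (p : ℝ) (hp0 : 0 < p) (hp1 : p ≤ 1) :
    ∃ C : ℝ, 0 < C ∧ ∀ f g : ℂ → ℂ,
      DifferentiableOn ℂ f (Metric.ball (0 : ℂ) 1) →
      DifferentiableOn ℂ g (Metric.ball (0 : ℂ) 1) →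
      IntegrableOn (fun z : ℂ => ‖deriv f z‖ * (1 - ‖z‖) ^ (1 / p - 1))
        (Metric.ball (0 : ℂ) 1) →
      ∀ Bg : ℝ, (∀ z : ℂ, ‖z‖ < 1 → ‖deriv g z‖ * (1 - ‖z‖ ^ 2) ^ 2 ≤ Bg) →
        ‖∫ z in Metric.ball (0 : ℂ) 1,
            f z * (starRingEnd ℂ) (g z) * ((1 - ‖z‖ ^ 2) ^ (1 / p - 1) : ℝ)‖ ≤
          C * (Bg + ‖g 0‖) *
            ((∫ z in Metric.ball (0 : ℂ) 1, ‖deriv f z‖ * (1 - ‖z‖) ^ (1 / p - 1)) +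
              ‖f 0‖) := by
  have hα : 0 ≤ 1 / p - 1 := sub_nonneg.2 ((le_div_iff₀ hp0).2 (by linarith))
  generalize 1 / p - 1 = α at hα
  set V := volume.real (Metric.ball (0 : ℂ) 1)
  have hV : 0 ≤ V := measureReal_nonneg
  have h2 : (0 : ℝ) < 2 ^ (α + 1) := by positivity
  refine ⟨2 ^ (α + 1) + V, by positivity, fun f g hf hg hfi B hB => ?_⟩
  have hB0 : 0 ≤ B := le_trans (by positivity) (hB 0 (by simp))
  set J := ∫ z in Metric.ball (0 : ℂ) 1, ‖deriv f z‖ * (1 - ‖z‖) ^ α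
  have hJ : 0 ≤ J := setIntegral_nonneg measurableSet_ball fun z hz =>
    mul_nonneg (norm_nonneg _) (Real.rpow_nonneg (by simpa using (mem_ball_zero_iff.1 hz).le) _)
  by_cases hint : IntegrableOn
    (fun z : ℂ => f z * (starRingEnd ℂ) (g z) * ((1 - ‖z‖ ^ 2) ^ α : ℝ)) (Metric.ball (0 : ℂ) 1)
  swap
  · rw [integral_undef hint, norm_zero]
    positivity
  have hle : 2 ^ (α + 1) * B * J + V * ‖f 0‖ * ‖g 0‖ ≤
      (2 ^ (α + 1) + V) * (B + ‖g 0‖) * (J + ‖f 0‖) := by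
    have : 0 ≤ 2 ^ (α + 1) * (B * ‖f 0‖ + ‖g 0‖ * J + ‖g 0‖ * ‖f 0‖) +
      V * (B * J + B * ‖f 0‖ + ‖g 0‖ * J) := by positivity
    linarith
  refine le_trans ?_ hle
  set χ : ℕ → ℝ → ℝ := fun n t => min 1 (max 0 (n * (1 - t) - 1)) with hχ
  have hχ0 : ∀ n t, 0 ≤ χ n t := fun n t => le_min zero_le_one (le_max_left _ _)
  have hχ1 : ∀ n t, χ n t ≤ 1 := fun n t => min_le_left _ _
  have hχs : ∀ (n : ℕ) t, 1 - 1 / ((n : ℝ) + 1) ≤ t → χ n t = 0 := fun n t ht => by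
    have h1 : (0 : ℝ) < n + 1 := by positivity
    have h3 : 1 - t ≤ 1 / ((n : ℝ) + 1) := by linarith
    rw [le_div_iff₀ h1] at h3
    have h4 : (n : ℝ) * (1 - t) - 1 ≤ 0 := by
      rcases le_total t 1 with h | h
      · linarith
      · nlinarith [n.cast_nonneg (α := ℝ)]
    simp [hχ, max_eq_left h4]
  set w : ℕ → ℝ → ℝ := fun n t => (1 - t) ^ α * χ n t with hwdef
  have hws : ∀ (n : ℕ) t, 1 - 1 / ((n : ℝ) + 1) ≤ t → w n t = 0 := fun n t ht => by
    simp [hwdef, hχs n t ht]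
  have hs : ∀ n : ℕ, 1 - 1 / ((n : ℝ) + 1) < 1 := fun n => by
    have : 0 < 1 / ((n : ℝ) + 1) := by positivity
    linarith
  have hwc : ∀ n, Continuous (w n) := fun n =>
    (Continuous.rpow_const (by fun_prop) fun _ => Or.inr hα).mul (by fun_prop)
  have hw0 : ∀ n t, 0 ≤ w n t := fun n t => by
    rcases le_total t 1 with h | h
    · exact mul_nonneg (Real.rpow_nonneg (by linarith) _) (hχ0 n t)
    · exact (hws n t ((hs n).le.trans h)).ge
  have hw1 : ∀ n, ∀ t < 1, w n t ≤ (1 - t) ^ α := fun n t ht =>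
    mul_le_of_le_one_right (Real.rpow_nonneg (by linarith) _) (hχ1 n t)
  have hlim : Filter.Tendsto
      (fun n => ∫ z in Metric.ball (0 : ℂ) 1,
        f z * (starRingEnd ℂ) (g z) * (w n (‖z‖ ^ 2) : ℂ)) Filter.atTop
      (nhds (∫ z in Metric.ball (0 : ℂ) 1,
        f z * (starRingEnd ℂ) (g z) * ((1 - ‖z‖ ^ 2) ^ α : ℝ))) := by
    refine tendsto_integral_of_dominated_convergence _ (fun n => ?_) hint.norm (fun n => ?_) ?_
    · exact (integrable_mul_radial (hf.continuousOn.mul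
        (continuous_conj.comp_continuousOn hg.continuousOn)) (hwc n) (hs n)
        (hws n)).aestronglyMeasurable.restrict
    · filter_upwards [ae_restrict_mem measurableSet_ball] with z hz
      have hz' : ‖z‖ < 1 := by simpa using hz
      have ht : ‖z‖ ^ 2 < 1 := by nlinarith [norm_nonneg z]
      rw [norm_mul, norm_mul _ (((1 - ‖z‖ ^ 2) ^ α : ℝ) : ℂ), norm_real, norm_real,
        Real.norm_of_nonneg (hw0 _ _),
        Real.norm_of_nonneg (Real.rpow_nonneg (by linarith) _)]
      exact mul_le_mul_of_nonneg_left (hw1 n _ ht) (norm_nonneg _)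
    · filter_upwards [ae_restrict_mem measurableSet_ball] with z hz
      have hz' : ‖z‖ < 1 := by simpa using hz
      have ht : 0 < 1 - ‖z‖ ^ 2 := by nlinarith [norm_nonneg z]
      refine tendsto_const_nhds.congr' ?_
      obtain ⟨N, hN⟩ := exists_nat_ge (2 / (1 - ‖z‖ ^ 2))
      filter_upwards [Filter.eventually_ge_atTop N] with n hn
      have h3 : 2 ≤ (n : ℝ) * (1 - ‖z‖ ^ 2) :=
        (div_le_iff₀ ht).1 (hN.trans (Nat.cast_le.2 hn))
      have h4 : χ n (‖z‖ ^ 2) = 1 := min_eq_left (le_max_of_le_right (by linarith))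
      simp only [hwdef, h4, mul_one]
  refine le_of_tendsto' hlim.norm fun n => ?_
  rw [setIntegral_eq_integral_of_forall_compl_eq_zero fun z hz => by
    have h1 : 1 ≤ ‖z‖ := by simpa using hz
    rw [hws n _ ((hs n).le.trans (by nlinarith)), ofReal_zero, mul_zero]]
  exact norm_integral_mul_conj_mul_radial_le hα hf hg hfi hB (hs n) (hwc n) (hws n) (hw0 n) (hw1 n)
end
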